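/- Let a, b be rational numbers with a > 0 and define P(m) = (2m+1)·(m(m+1)·((3m²+3m−1)·a + b) + 1) for integers m. If P(3) ≥ 7, then P(m) ≥ 7 for every integer m ≥ 3. -/

import Mathlib

theorem stmt_7 (a b : ℚ) (ha : a > 0) (P : ℤ → ℚ)
    (hP : ∀ m : ℤ, P m = (2*m+1) * (m*(m+1) * ((3*m^2+3*m-1)*a + b) + 1))
    (h3 : P 3 ≥ 7) :
    ∀ m : ℤ, m ≥ 3 → P m ≥ 7 := by
  intro m hm
  have hm' : (3 : ℚ) ≤ m := by exact_mod_cast hm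
  rw [hP] at h3 ⊢
  push_cast at h3
  have hb : 0 ≤ 35 * a + b := by linarith
  have hcoef : (35 : ℚ) ≤ 3 * m ^ 2 + 3 * m - 1 := by nlinarith
  have hfactor : 0 ≤ (3 * (m : ℚ) ^ 2 + 3 * m - 1) * a + b := by
    linarith [mul_le_mul_of_nonneg_right hcoef ha.le]
  have hprod : 0 ≤ (m : ℚ) * (m + 1) * ((3 * m ^ 2 + 3 * m - 1) * a + b) :=
    mul_nonneg (by positivity) hfactor
  nlinarith
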